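/- Let K be a number field of degree n, p a prime, and suppose that for every κ ≥ 1 the number λ_κ of distinct prime ideals of 𝒪_K above p of residual degree κ satisfies λ_κ ≤ ḡ(κ), the number of monic irreducible polynomials of degree κ over 𝔽_p. Then there exists an algebraic integer ξ₀ ∈ 𝒪_K such that 1, ξ₀, ξ₀², …, ξ₀^{n-1} are linearly independent over 𝔽_p in 𝒪_K/p𝒪_K, i.e., p does not divide the index [𝒪_K : ℤ[ξ₀]]. -/

import Mathlib

open NumberField Polynomial

theorem Function.Embedding.nonempty_of_natCard_le {α β : Type*} [Finite α]
    (h : Nat.card α ≤ Nat.card β) : Nonempty (α ↪ β) := by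
  rcases finite_or_infinite β with hβ | hβ
  · have := Fintype.ofFinite α
    have := Fintype.ofFinite β
    rw [Nat.card_eq_fintype_card, Nat.card_eq_fintype_card] at h
    exact Function.Embedding.nonempty_of_card_le h
  · rw [Nat.card_eq_zero_of_infinite (α := β), Nat.le_zero, Finite.card_eq_zero_iff] at h
    exact ⟨Function.Embedding.ofIsEmpty⟩

/-- An irreducible polynomial of degree `κ` over `𝔽_p` has a root in a field with `p ^ κ`
elements, and this root generates the field. -/
theorem FiniteField.exists_aeval_eq_zero_and_aeval_surjective {p κ : ℕ} [Fact p.Prime]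
    {k : Type*} [Field k] [Algebra (ZMod p) k] [Finite k] (hk : Nat.card k = p ^ κ)
    {g : (ZMod p)[X]} (hg : Irreducible g) (hdeg : g.natDegree = κ) :
    ∃ α : k, aeval α g = 0 ∧ Function.Surjective fun q : (ZMod p)[X] => aeval α q := by
  have := Fact.mk hg
  have hfin : Module.Finite (ZMod p) (AdjoinRoot g) :=
    (AdjoinRoot.powerBasis hg.ne_zero).finite
  have : Finite (AdjoinRoot g) := Module.finite_of_finite (ZMod p)
  have := Fintype.ofFinite k
  have := Fintype.ofFinite (AdjoinRoot g)
  have hcard : Fintype.card (AdjoinRoot g) = Fintype.card k := by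
    rw [← Nat.card_eq_fintype_card, ← Nat.card_eq_fintype_card, hk,
      Module.natCard_eq_pow_finrank (K := ZMod p), (AdjoinRoot.powerBasis hg.ne_zero).finrank,
      AdjoinRoot.powerBasis_dim, hdeg, Nat.card_zmod]
  let φ := FiniteField.algEquivOfCardEq p hcard
  have key (q : (ZMod p)[X]) : aeval (φ (AdjoinRoot.root g)) q = φ (AdjoinRoot.mk g q) := by
    rw [← AdjoinRoot.aeval_eq]; exact aeval_algHom_apply (φ : AdjoinRoot g →ₐ[ZMod p] k) _ _
  refine ⟨φ (AdjoinRoot.root g), ?_, fun y => ?_⟩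
  · rw [key, AdjoinRoot.mk_self, map_zero]
  · obtain ⟨q, hq⟩ := AdjoinRoot.mk_surjective (φ.symm y)
    exact ⟨q, by simp [key, hq]⟩

theorem Polynomial.aeval_sub_aeval_mem {R : Type*} [CommRing R] {I : Ideal R} {x y : R}
    (h : x - y ∈ I) (Q : ℤ[X]) : aeval x Q - aeval y Q ∈ I := by
  have hdvd := (Q.map (algebraMap ℤ R)).sub_dvd_eval_sub x y
  rw [eval_map_algebraMap, eval_map_algebraMap] at hdvd
  exact I.mem_of_dvd hdvd h

theorem Ideal.Quotient.mk_aeval_int {R : Type*} [CommRing R] (P : Ideal R) {p : ℕ}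
    [Algebra (ZMod p) (R ⧸ P)] (G : ℤ[X]) (a : R) :
    Ideal.Quotient.mk P (aeval a G) =
      aeval (Ideal.Quotient.mk P a) (G.map (Int.castRingHom (ZMod p))) := by
  rw [aeval_def, aeval_def, eval₂_map, hom_eval₂]
  congr 1
  exact RingHom.ext_int _ _

/-- A monic irreducible polynomial over `𝔽_p` whose degree is the residual degree of `P`
can be evaluated at an element generating the residue field so that the value has
`P`-adic valuation exactly one. -/
theorem exists_aeval_mem_and_notMem_sq {R : Type*} [CommRing R] [IsDedekindDomain R]
    {P : Ideal R} [P.IsMaximal] (hP : P ≠ ⊥) {p κ : ℕ} [Fact p.Prime] (hpP : (p : R) ∈ P)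
    (hcard : Nat.card (R ⧸ P) = p ^ κ) {G : ℤ[X]}
    (hG : Irreducible (G.map (Int.castRingHom (ZMod p))))
    (hdeg : (G.map (Int.castRingHom (ZMod p))).natDegree = κ) :
    ∃ a : R, aeval a G ∈ P ∧ aeval a G ∉ P ^ 2 ∧ ∀ x, ∃ Q : ℤ[X], x - aeval a Q ∈ P := by
  let := Ideal.Quotient.field P
  have : Finite (R ⧸ P) :=
    Nat.finite_of_card_ne_zero (hcard ▸ pow_ne_zero _ (Fact.out : p.Prime).ne_zero)
  have : CharP (R ⧸ P) p := by
    refine (CharP.charP_iff_prime_eq_zero Fact.out).mpr ?_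
    rwa [← map_natCast (Ideal.Quotient.mk P), Ideal.Quotient.eq_zero_iff_mem]
  let := ZMod.algebra (R ⧸ P) p
  obtain ⟨α, hα, hsurj⟩ :=
    FiniteField.exists_aeval_eq_zero_and_aeval_surjective hcard hG hdeg
  obtain ⟨a, rfl⟩ := Ideal.Quotient.mk_surjective α
  have hgen (x) : ∃ Q : ℤ[X], x - aeval a Q ∈ P := by
    obtain ⟨q, hq⟩ := hsurj (Ideal.Quotient.mk P x)
    obtain ⟨Q, rfl⟩ := map_surjective (Int.castRingHom (ZMod p)) (ZMod.ringHom_surjective _) q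
    refine ⟨Q, ?_⟩
    rw [← Ideal.Quotient.mk_eq_mk_iff_sub_mem, Ideal.Quotient.mk_aeval_int P (p := p)]
    exact hq.symm
  have hmem : aeval a G ∈ P := by
    rw [← Ideal.Quotient.eq_zero_iff_mem, Ideal.Quotient.mk_aeval_int P (p := p), hα]
  by_cases hsq : aeval a G ∈ P ^ 2
  swap
  · exact ⟨a, hmem, hsq, hgen⟩
  have hder : aeval a (derivative G) ∉ P := by
    rw [← Ideal.Quotient.eq_zero_iff_mem, Ideal.Quotient.mk_aeval_int P (p := p),
      ← derivative_map]
    exact (PerfectField.separable_of_irreducible hG).aeval_derivative_ne_zero hα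
  obtain ⟨t, htP, ht⟩ : ∃ t ∈ P, t ∉ P ^ 2 :=
    by
    simpa using P.exists_mem_pow_notMem_pow_succ hP Ideal.IsPrime.ne_top' 1
  have hsub (Q : ℤ[X]) : aeval (a + t) Q - aeval a Q ∈ P :=
    aeval_sub_aeval_mem (by simpa using htP) Q
  have hexp : aeval (a + t) G - (aeval a G + aeval a (derivative G) * t) ∈ P ^ 2 := by
    rw [← Ideal.Quotient.mk_eq_mk_iff_sub_mem]
    have ht2 : (Ideal.Quotient.mk (P ^ 2) t) ^ 2 = 0 := by
      rw [← map_pow, Ideal.Quotient.eq_zero_iff_mem]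
      exact Ideal.pow_mem_pow htP 2
    have key (x : R) (Q : ℤ[X]) :
        Ideal.Quotient.mk (P ^ 2) (aeval x Q) = aeval (Ideal.Quotient.mk (P ^ 2) x) Q :=
      (aeval_algHom_apply (Ideal.Quotient.mkₐ ℤ (P ^ 2)) x Q).symm
    rw [key, map_add, aeval_add_of_sq_eq_zero _ _ _ ht2, map_add, map_mul, key, key]
  refine ⟨a + t, ?_, fun hc => ?_, fun x => ?_⟩
  · simpa using P.add_mem (hsub G) hmem
  · have : aeval a (derivative G) * t ∈ P ^ 2 := by
      convert sub_mem (sub_mem hc hexp) hsq using 1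
      ring
    rcases (inferInstance : P.IsPrime).mul_mem_pow P this with h | h
    · exact hder h
    · exact ht h
  · obtain ⟨Q, hQ⟩ := hgen x
    exact ⟨Q, by simpa using sub_mem hQ (hsub Q)⟩

/-- If `R = A + 𝔪 R` for every maximal ideal `𝔪` of `A` containing `p`, then some integer
congruent to `1` modulo `p` multiplies `R` into `A`. -/
theorem Subalgebra.exists_dvd_sub_one_and_smul_mem {R : Type*} [CommRing R] [Module.Finite ℤ R]
    (A : Subalgebra ℤ R) (p : ℤ)
    (h : ∀ m : Ideal A, m.IsMaximal → (p : A) ∈ m →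
      ∀ x : R, ∃ a ∈ A, x - a ∈ m.map (algebraMap A R)) :
    ∃ r : ℤ, p ∣ r - 1 ∧ ∀ x : R, r • x ∈ A := by
  have : Module.Finite A R := Module.Finite.of_restrictScalars_finite ℤ A R
  let N : Submodule A R := LinearMap.range (Algebra.linearMap A R)
  have hN {x : R} : x ∈ N ↔ x ∈ A := by simp [N]
  let c : Ideal A := N.colon (⊤ : Submodule A R)
  have hc : c ⊔ Ideal.span {(p : A)} = ⊤ := by
    by_contra hne
    obtain ⟨m, hm, hle⟩ := Ideal.exists_le_maximal _ hne
    obtain ⟨hcm, hpm⟩ := sup_le_iff.mp hle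
    rw [Ideal.span_singleton_le_iff_mem] at hpm
    have hsup : (⊤ : Submodule A R) ≤ N ⊔ m • ⊤ := by
      intro x _
      obtain ⟨a, ha, hxa⟩ := h m hm hpm x
      rw [Ideal.smul_top_eq_map, Submodule.mem_sup]
      exact ⟨a, hN.mpr ha, x - a, hxa, by ring⟩
    obtain ⟨r, hr1, hr⟩ := Submodule.exists_sub_one_mem_and_smul_le_of_fg_of_le_sup
      Module.Finite.fg_top le_rfl hsup
    have hrm : r ∈ m := hcm <| Submodule.mem_colon.mpr fun x _ =>
      hr (Submodule.smul_mem_pointwise_smul x r ⊤ trivial)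
    exact hm.ne_top ((Ideal.eq_top_iff_one m).mpr (by simpa using sub_mem hrm hr1))
  obtain ⟨a, ha, b, hb, hab⟩ := Submodule.mem_sup.mp (hc ▸ Submodule.mem_top : (1 : A) ∈ _)
  obtain ⟨b, rfl⟩ := Ideal.mem_span_singleton'.mp hb
  have hsup : (⊤ : Submodule ℤ R) ≤ A.toSubmodule ⊔ Ideal.span {p} • ⊤ := by
    intro x _
    refine Submodule.mem_sup.mpr ⟨a • x, hN.mp (Submodule.mem_colon.mp ha x trivial), p • (b • x),
      Submodule.smul_mem_smul (Ideal.mem_span_singleton_self p) trivial, ?_⟩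
    have := congrArg (fun y : A => (y : R) * x) hab
    simp only [Subalgebra.coe_add, Subalgebra.coe_mul, OneMemClass.coe_one, one_mul] at this
    conv_rhs => rw [← this]
    simp only [Subalgebra.smul_def, smul_eq_mul, zsmul_eq_mul, SubringClass.coe_intCast]
    ring
  obtain ⟨r, hr1, hr⟩ := Submodule.exists_sub_one_mem_and_smul_le_of_fg_of_le_sup
    Module.Finite.fg_top le_rfl hsup
  exact ⟨r, Ideal.mem_span_singleton.mp hr1, fun x =>
    hr (Submodule.smul_mem_pointwise_smul x r ⊤ trivial)⟩

/-- A subgroup containing `r 𝒪_K` for an integer `r` prime to `p` has index prime to `p`. -/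
theorem NumberField.not_dvd_index_of_smul_mem {K : Type*} [Field K] [NumberField K] {p : ℕ}
    (hp : p.Prime) (A : AddSubgroup (𝓞 K)) {r : ℤ} (hr : (p : ℤ) ∣ r - 1)
    (h : ∀ x : 𝓞 K, r • x ∈ A) : ¬ p ∣ A.index := by
  have hle : (Ideal.span {(r : 𝓞 K)}).toAddSubgroup ≤ A := by
    intro y hy
    obtain ⟨x, rfl⟩ := Ideal.mem_span_singleton.mp hy
    simpa using h x
  have hnorm : (Ideal.span {(r : 𝓞 K)}).toAddSubgroup.index =
      r.natAbs ^ Module.finrank ℤ (𝓞 K) := by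
    have := Ideal.absNorm_span_singleton (r : 𝓞 K)
    rw [← eq_intCast (algebraMap ℤ (𝓞 K)), Algebra.norm_algebraMap, Int.natAbs_pow] at this
    exact this
  intro hdvd
  have := hp.dvd_of_dvd_pow (hnorm ▸ hdvd.trans (AddSubgroup.index_dvd_of_le hle))
  have h1 := (dvd_sub_right (Int.natCast_dvd.mpr this)).mp hr
  exact hp.one_lt.ne' (Nat.dvd_one.mp (by exact_mod_cast h1))

/-- If `ξ` generates every residue field at `p` and uniformizers at the primes above `p` are
obtained as `G P (ξ)`, where `G P (ξ)` lies in no other prime above `p`, then `p` does not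
divide the index of `ℤ[ξ]`. -/
theorem NumberField.not_dvd_index_adjoin {K : Type*} [Field K] [NumberField K] {p : ℕ}
    (hp : p.Prime) (ξ : 𝓞 K)
    (h : ∀ P : Ideal (𝓞 K), P.IsMaximal → (p : 𝓞 K) ∈ P →
      (∀ x, ∃ Q : ℤ[X], x - aeval ξ Q ∈ P) ∧
      ∃ G : ℤ[X], aeval ξ G ∈ P ∧ aeval ξ G ∉ P ^ 2 ∧
        ∀ Q : Ideal (𝓞 K), Q.IsMaximal → (p : 𝓞 K) ∈ Q → aeval ξ G ∈ Q → Q = P) :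
    ¬ p ∣ (Algebra.adjoin ℤ {ξ}).toSubring.toAddSubgroup.index := by
  have haeval (Q : ℤ[X]) : aeval ξ Q ∈ Algebra.adjoin ℤ {ξ} := aeval_mem_adjoin_singleton ℤ ξ
  obtain ⟨r, hr, hrA⟩ := (Algebra.adjoin ℤ {ξ}).exists_dvd_sub_one_and_smul_mem p
    fun m hm hpm x => by
      have : Algebra.IsIntegral (Algebra.adjoin ℤ {ξ}) (𝓞 K) :=
        Algebra.IsIntegral.tower_top (R := ℤ)
      obtain ⟨P, hP, hPm⟩ := Ideal.exists_ideal_over_maximal_of_isIntegral (S := 𝓞 K) m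
        (by simp)
      have hmem {y : Algebra.adjoin ℤ {ξ}} : y ∈ m ↔ (y : 𝓞 K) ∈ P := by rw [← hPm]; rfl
      have hpP : (p : 𝓞 K) ∈ P := by simpa using hmem.mp hpm
      obtain ⟨hgen, G, hGP, hG2, hGQ⟩ := h P hP hpP
      set I := m.map (algebraMap (Algebra.adjoin ℤ {ξ}) (𝓞 K))
      have hIP : I = P := by
        have hle : I ≤ P := Ideal.map_le_iff_le_comap.mpr hPm.ge
        obtain ⟨J, hJ⟩ := Ideal.dvd_iff_le.mpr hle
        by_cases hJt : J = ⊤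
        · rw [hJ, hJt, Ideal.mul_top]
        obtain ⟨Q, hQ, hJQ⟩ := Ideal.exists_le_maximal J hJt
        have hpI : (p : 𝓞 K) ∈ I := by
          have := Ideal.mem_map_of_mem (algebraMap (Algebra.adjoin ℤ {ξ}) (𝓞 K)) hpm
          rwa [map_intCast, Int.cast_natCast] at this
        have hGI : aeval ξ G ∈ I := Ideal.mem_map_of_mem
          (algebraMap (Algebra.adjoin ℤ {ξ}) (𝓞 K)) (hmem.mpr hGP : ⟨_, haeval G⟩ ∈ m)
        have hIQ : I ≤ Q := hJ.le.trans (Ideal.mul_le_right.trans hJQ)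
        obtain rfl := hGQ Q hQ (hIQ hpI) (hIQ hGI)
        refine absurd ?_ hG2
        rw [pow_two]
        exact Ideal.mul_mono_right hJQ (hJ ▸ hGI)
      obtain ⟨Q, hQ⟩ := hgen x
      exact ⟨_, haeval Q, hIP ▸ hQ⟩
  exact NumberField.not_dvd_index_of_smul_mem hp _ hr hrA

/-- If for every residual degree `κ ≥ 1` the number of distinct primes of `𝒪_K` above
`p` with residual degree `κ` is at most the number of monic irreducible polynomials of
degree `κ` over `𝔽_p`, then there is `ξ₀ ∈ 𝒪_K` whose index `[𝒪_K : ℤ[ξ₀]]` is not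
divisible by `p`. -/
theorem exists_element_index_not_dvd
    (K : Type*) [Field K] [NumberField K] (p : ℕ) (hp : p.Prime)
    (h : ∀ κ : ℕ, 0 < κ →
      Nat.card {P : Ideal (𝓞 K) //
          P.IsPrime ∧ (p : 𝓞 K) ∈ P ∧ Ideal.absNorm P = p ^ κ}
        ≤ Nat.card {f : (ZMod p)[X] // f.Monic ∧ Irreducible f ∧ f.natDegree = κ}) :
    ∃ ξ₀ : 𝓞 K, ¬ p ∣ ((Algebra.adjoin ℤ {ξ₀}).toSubring.toAddSubgroup.index) := by
  have := Fact.mk hp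
  have hp0 : (p : 𝓞 K) ≠ 0 := Nat.cast_ne_zero.mpr hp.ne_zero
  let S : Set (Ideal (𝓞 K)) := {P | P.IsMaximal ∧ (p : 𝓞 K) ∈ P}
  have hbot {P : Ideal (𝓞 K)} (hP : P ∈ S) : P ≠ ⊥ := by
    rintro rfl
    exact hp0 hP.2
  have hnorm (P : S) : ∃ κ ≤ Module.finrank ℤ (𝓞 K), Ideal.absNorm P.1 = p ^ κ := by
    refine (Nat.dvd_prime_pow hp).mp ?_
    have := Ideal.absNorm_dvd_absNorm_of_le
      ((Ideal.span_singleton_le_iff_mem _).mpr P.2.2)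
    rwa [Ideal.absNorm_span_singleton, ← map_natCast (algebraMap ℤ (𝓞 K)),
      Algebra.norm_algebraMap, Int.natAbs_pow, Int.natAbs_natCast] at this
  choose κ hκle hκ using hnorm
  have hκpos (P : S) : 0 < κ P := by
    refine Nat.pos_of_ne_zero fun h0 => P.2.1.ne_top ?_
    rw [← Ideal.absNorm_eq_one_iff, hκ, h0, pow_zero]
  have hSfin : S.Finite := by
    refine (Ideal.finite_setOfPred_absNorm_le (p ^ Module.finrank ℤ (𝓞 K))).subset fun P hP => ?_
    exact (hκ ⟨P, hP⟩).trans_le (Nat.pow_le_pow_right hp.pos (hκle _))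
  have hemb (k : ℕ) (hk : 0 < k) : Nonempty
      ({P : Ideal (𝓞 K) // P.IsPrime ∧ (p : 𝓞 K) ∈ P ∧ Ideal.absNorm P = p ^ k} ↪
        {f : (ZMod p)[X] // f.Monic ∧ Irreducible f ∧ f.natDegree = k}) := by
    have : Finite {P : Ideal (𝓞 K) // P.IsPrime ∧ (p : 𝓞 K) ∈ P ∧ Ideal.absNorm P = p ^ k} :=
      (hSfin.subset fun P hP => ⟨hP.1.isMaximal fun h0 => hp0 (by simpa [h0] using hP.2.1),
        hP.2.1⟩ : {P : Ideal (𝓞 K) | P.IsPrime ∧ (p : 𝓞 K) ∈ P ∧ Ideal.absNorm P = p ^ k}.Finite)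
    exact Function.Embedding.nonempty_of_natCard_le (h k hk)
  let ι (k : ℕ) (hk : 0 < k) := (hemb k hk).some
  let g (P : S) : (ZMod p)[X] :=
    (ι (κ P) (hκpos P) ⟨P.1, P.2.1.isPrime, P.2.2, hκ P⟩).1
  have hg (P : S) : (g P).Monic ∧ Irreducible (g P) ∧ (g P).natDegree = κ P :=
    (ι (κ P) (hκpos P) ⟨P.1, P.2.1.isPrime, P.2.2, hκ P⟩).2
  have hginj (P Q : S) (hPQ : g P = g Q) : P = Q := by
    have hk : κ P = κ Q := by rw [← (hg P).2.2, ← (hg Q).2.2, hPQ]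
    have key (P : S) (k : ℕ) (hk : 0 < k) (hP : Ideal.absNorm P.1 = p ^ k) (hPk : κ P = k) :
        g P = (ι k hk ⟨P.1, P.2.1.isPrime, P.2.2, hP⟩).1 := by
      subst hPk
      rfl
    rw [key P _ (hκpos P) (hκ P) rfl, key Q _ (hκpos P) (hk ▸ hκ Q) hk.symm] at hPQ
    exact Subtype.ext (congrArg (fun I => I.1) ((ι _ (hκpos P)).injective (Subtype.ext hPQ)))
  choose G hGmap using fun P : S =>
    map_surjective (Int.castRingHom (ZMod p)) (ZMod.ringHom_surjective _) (g P)
  have hloc (P : S) : ∃ a : 𝓞 K, aeval a (G P) ∈ P.1 ∧ aeval a (G P) ∉ P.1 ^ 2 ∧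
      ∀ x, ∃ Q : ℤ[X], x - aeval a Q ∈ P.1 := by
    have := P.2.1
    refine exists_aeval_mem_and_notMem_sq (hbot P.2) P.2.2 (hκ P) (κ := κ P) ?_ ?_
    · exact hGmap P ▸ (hg P).2.1
    · exact hGmap P ▸ (hg P).2.2
  choose a ha ha2 hagen using hloc
  have := hSfin.fintype
  obtain ⟨ξ, hξ⟩ := IsDedekindDomain.exists_forall_sub_mem_ideal (s := Finset.univ)
    (fun P : S => P.1) (fun _ => 2)
    (fun P _ => Ideal.prime_of_isPrime (hbot P.2) P.2.1.isPrime)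
    (fun P _ Q _ hPQ => Subtype.coe_injective.ne hPQ) (fun P => a P.1)
  have hξ2 (P : S) (Q : ℤ[X]) : aeval ξ Q - aeval (a P) Q ∈ P.1 ^ 2 :=
    aeval_sub_aeval_mem (hξ P (Finset.mem_univ P)) Q
  have hξ1 (P : S) (Q : ℤ[X]) : aeval ξ Q - aeval (a P) Q ∈ P.1 :=
    Ideal.pow_le_self two_ne_zero (hξ2 P Q)
  have hGP (P : S) : aeval ξ (G P) ∈ P.1 := by
    simpa using add_mem (hξ1 P (G P)) (ha P)
  refine ⟨ξ, NumberField.not_dvd_index_adjoin hp ξ fun P hP hpP => ⟨fun x => ?_,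
    G ⟨P, hP, hpP⟩, hGP ⟨P, hP, hpP⟩, fun hc => ?_, fun Q hQ hpQ hGQ => ?_⟩⟩
  · obtain ⟨Q, hQ⟩ := hagen ⟨P, hP, hpP⟩ x
    exact ⟨Q, by simpa using sub_mem hQ (hξ1 ⟨P, hP, hpP⟩ Q)⟩
  · exact ha2 ⟨P, hP, hpP⟩ (by simpa using sub_mem hc (hξ2 ⟨P, hP, hpP⟩ (G ⟨P, hP, hpP⟩)))
  · by_contra hne
    have := Ideal.Quotient.field Q
    have hgne : g ⟨P, hP, hpP⟩ ≠ g ⟨Q, hQ, hpQ⟩ := fun he =>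
      hne (congrArg Subtype.val (hginj _ _ he)).symm
    have : CharP (𝓞 K ⧸ Q) p := by
      refine (CharP.charP_iff_prime_eq_zero hp).mpr ?_
      rwa [← map_natCast (Ideal.Quotient.mk Q), Ideal.Quotient.eq_zero_iff_mem]
    let := ZMod.algebra (𝓞 K ⧸ Q) p
    have hroot (P : S) (hPQ : aeval ξ (G P) ∈ Q) : aeval (Ideal.Quotient.mk Q ξ) (g P) = 0 := by
      rw [← hGmap, ← Ideal.Quotient.mk_aeval_int, Ideal.Quotient.eq_zero_iff_mem]
      exact hPQ
    have hcop : IsCoprime (g ⟨P, hP, hpP⟩) (g ⟨Q, hQ, hpQ⟩) := by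
      refine (hg _).2.1.coprime_iff_not_dvd.mpr fun hd => hgne ?_
      exact eq_of_monic_of_associated (hg _).1 (hg _).1
        ((hg _).2.1.associated_of_dvd (hg _).2.1 hd)
    obtain ⟨u, v, huv⟩ := hcop
    have := congrArg (aeval (Ideal.Quotient.mk Q ξ)) huv
    rw [map_add, map_mul, map_mul, hroot _ hGQ, hroot _ (hGP ⟨Q, hQ, hpQ⟩), mul_zero,
      mul_zero, add_zero, map_one] at this
    exact zero_ne_one this
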